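/- arXiv:1705.04649 — 2 statements merged into one kernel-verified Lean document; each statement's English description precedes it below -/
import Mathlib

section
/- Let M be the 6×6 matrix over ℤ[q] with rows: row 1: (q⁴+q³−q²−q, q³−q, q⁵−2q⁴−q³+2q², q⁵−q³, q⁶−2q⁵−q⁴+2q, −2q⁴−q³+2q²+q); row 2: (q³−q, q⁴+q³−q²−q, q⁵−q³, q⁵−2q⁴−q³+2q², q⁶−2q⁵−q⁴+2q, −2q⁴−q³+2q²+q); row 3: (q³−2q², q³, q⁵+q⁴−3q³+3q², q⁵−3q³, q⁶−2q⁵−3q⁴+4q³, −2q⁴+2q³); row 4: (q³, q³−2q², q⁵−3q³, q⁵+q⁴−3q³+3q², q⁶−2q⁵−3q⁴+4q³, −2q⁴+2q³); row 5: (q³, q³, q⁵−3q³, q⁵−3q³, q⁶−2q⁵−2q⁴+4q³+q², −2q⁴); row 6: (−1, −1, 2q², 2q², −4q²+2, q⁴−2q²+2q+1). For g ≥ 0 set v^g = M^g·(1,0,0,0,0,0)ᵗ and write v^g = (ẽ₀^g, ẽ₁^g, ẽ₂^g, ẽ₃^g, ã^g, b̃^g). Then for every g ≥ 1, the identity 2·ẽ₂^g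 = 2(q³−q)^{2g−1} − q(q²+q)^{2g−1} + (q−2)(q²−q)^{2g−1} holds in ℤ[q]. -/
open Polynomial Matrix

noncomputable section

/-- The indeterminate `q` of `ℤ[q]`. -/
def q : Polynomial ℤ := Polynomial.X

/-- The transition matrix `M` of the genus-adding handle attachment. -/
def M : Matrix (Fin 6) (Fin 6) (Polynomial ℤ) :=
  !![q^4+q^3-q^2-q, q^3-q, q^5-2*q^4-q^3+2*q^2, q^5-q^3, q^6-2*q^5-q^4+2*q, -2*q^4-q^3+2*q^2+q;
     q^3-q, q^4+q^3-q^2-q, q^5-q^3, q^5-2*q^4-q^3+2*q^2, q^6-2*q^5-q^4+2*q, -2*q^4-q^3+2*q^2+q;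
     q^3-2*q^2, q^3, q^5+q^4-3*q^3+3*q^2, q^5-3*q^3, q^6-2*q^5-3*q^4+4*q^3, -2*q^4+2*q^3;
     q^3, q^3-2*q^2, q^5-3*q^3, q^5+q^4-3*q^3+3*q^2, q^6-2*q^5-3*q^4+4*q^3, -2*q^4+2*q^3;
     q^3, q^3, q^5-3*q^3, q^5-3*q^3, q^6-2*q^5-2*q^4+4*q^3+q^2, -2*q^4;
     -1, -1, 2*q^2, 2*q^2, -4*q^2+2, q^4-2*q^2+2*q+1]

/-- `v g = M^g · (1,0,0,0,0,0)ᵗ`, whose components are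
`(ẽ₀^g, ẽ₁^g, ẽ₂^g, ẽ₃^g, ã^g, b̃^g)`. -/
def v (g : ℕ) : Fin 6 → Polynomial ℤ :=
  (M ^ g).mulVec ![1, 0, 0, 0, 0, 0]

/-- The third row of `M ^ g` satisfies a linear recurrence of order three with
characteristic roots `(q^3-q)^2`, `(q^2+q)^2`, `(q^2-q)^2`. -/
theorem single_vecMul_M_cube :
    ((![0, 0, 1, 0, 0, 0] ᵥ* M) ᵥ* M) ᵥ* M =
      ((q^3-q)^2 + (q^2+q)^2 + (q^2-q)^2) • ((![0, 0, 1, 0, 0, 0] ᵥ* M) ᵥ* M)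
      - ((q^3-q)^2 * (q^2+q)^2 + (q^3-q)^2 * (q^2-q)^2 + (q^2+q)^2 * (q^2-q)^2) •
        (![0, 0, 1, 0, 0, 0] ᵥ* M)
      + ((q^3-q)^2 * (q^2+q)^2 * (q^2-q)^2) • ![0, 0, 1, 0, 0, 0] := by
  have row_one : ![0, 0, 1, 0, 0, 0] ᵥ* M =
      ![q^3-2*q^2, q^3, q^5+q^4-3*q^3+3*q^2, q^5-3*q^3, q^6-2*q^5-3*q^4+4*q^3,
        -2*q^4+2*q^3] := by
    ext1 i
    fin_cases i <;> simp [M, vecMul, dotProduct, Fin.sum_univ_succ]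
  rw [row_one]
  ext1 i
  fin_cases i <;> simp [M, vecMul, dotProduct, Fin.sum_univ_succ] <;> ring

theorem v_succ (g : ℕ) : v (g + 1) = M *ᵥ v g := by
  simp [v, pow_succ', mulVec_mulVec]

theorem v_zero : v 0 = ![1, 0, 0, 0, 0, 0] := by
  simp [v]

theorem v_apply_two (g : ℕ) : v g 2 = ![0, 0, 1, 0, 0, 0] ⬝ᵥ v g := by
  simp [dotProduct, Fin.sum_univ_succ]

theorem v_add_three_apply_two (g : ℕ) :
    v (g + 3) 2 = ((q^3-q)^2 + (q^2+q)^2 + (q^2-q)^2) * v (g + 2) 2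
      - ((q^3-q)^2 * (q^2+q)^2 + (q^3-q)^2 * (q^2-q)^2 + (q^2+q)^2 * (q^2-q)^2) * v (g + 1) 2
      + ((q^3-q)^2 * (q^2+q)^2 * (q^2-q)^2) * v g 2 := by
  simp only [v_apply_two, v_succ, dotProduct_mulVec]
  rw [single_vecMul_M_cube]
  simp only [add_dotProduct, sub_dotProduct, smul_dotProduct, smul_eq_mul]

theorem v_one : v 1 = ![q^4+q^3-q^2-q, q^3-q, q^3-2*q^2, q^3, q^3, -1] := by
  rw [v_succ, v_zero]
  ext1 i
  fin_cases i <;> simp [M, mulVec, dotProduct, Fin.sum_univ_succ]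

theorem v_two_apply_two :
    2 * v 2 2 = 2*(q^3-q)^3 - q*(q^2+q)^3 + (q-2)*(q^2-q)^3 := by
  rw [v_succ, v_one]
  simp [M, mulVec, dotProduct, Fin.sum_univ_succ]
  ring

theorem two_mul_v_succ_apply_two (g : ℕ) :
    2 * v (g + 1) 2 =
      2*(q^3-q)^(2*g+1) - q*(q^2+q)^(2*g+1) + (q-2)*(q^2-q)^(2*g+1) := by
  induction g using Nat.strong_induction_on with
  | _ g ih =>
    match g, ih with
    | 0, _ =>
      simp [v_one]
      ring
    | 1, _ => exact v_two_apply_two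
    | 2, _ =>
      have h_rec := v_add_three_apply_two 0
      have h_zero : v 0 2 = 0 := by simp [v_zero]
      have h_one : v 1 2 = q^3-2*q^2 := by simp [v_one]
      simp only [zero_add, h_zero, h_one] at h_rec
      linear_combination 2 * h_rec + ((q^3-q)^2 + (q^2+q)^2 + (q^2-q)^2) * v_two_apply_two
    | g + 3, ih =>
      have h_zero := ih g (by lia)
      have h_one := ih (g + 1) (by lia)
      have h_two := ih (g + 2) (by lia)
      have h_rec := v_add_three_apply_two (g + 1)
      have expand (x : Polynomial ℤ) (k : ℕ) : x^(2*(g+k)+1) = x^(2*g+1) * (x^2)^k := by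
        ring
      simp only [expand, add_right_comm g 1] at h_one h_two h_rec ⊢
      linear_combination 2 * h_rec + ((q^3-q)^2 + (q^2+q)^2 + (q^2-q)^2) * h_two
        - ((q^3-q)^2 * (q^2+q)^2 + (q^3-q)^2 * (q^2-q)^2 + (q^2+q)^2 * (q^2-q)^2) * h_one
        + ((q^3-q)^2 * (q^2+q)^2 * (q^2-q)^2) * h_zero

theorem stmt_2 (g : ℕ) (hg : 1 ≤ g) :
    2 * v g 2 =
      2*(q^3-q)^(2*g-1) - q*(q^2+q)^(2*g-1) + (q-2)*(q^2-q)^(2*g-1) := by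
  obtain ⟨k, rfl⟩ := Nat.exists_eq_add_of_le' hg
  exact two_mul_v_succ_apply_two k
end
end

section
/- Let M be the 6×6 matrix over ℤ[q] with rows: row 1: (q⁴+q³−q²−q, q³−q, q⁵−2q⁴−q³+2q², q⁵−q³, q⁶−2q⁵−q⁴+2q, −2q⁴−q³+2q²+q); row 2: (q³−q, q⁴+q³−q²−q, q⁵−q³, q⁵−2q⁴−q³+2q², q⁶−2q⁵−q⁴+2q, −2q⁴−q³+2q²+q); row 3: (q³−2q², q³, q⁵+q⁴−3q³+3q², q⁵−3q³, q⁶−2q⁵−3q⁴+4q³, −2q⁴+2q³); row 4: (q³, q³−2q², q⁵−3q³, q⁵+q⁴−3q³+3q², q⁶−2q⁵−3q⁴+4q³, −2q⁴+2q³); row 5: (q³, q³, q⁵−3q³, q⁵−3q³, q⁶−2q⁵−2q⁴+4q³+q², −2q⁴); row 6: (−1, −1, 2q², 2q², −4q²+2, q⁴−2q²+2q+1). For g ≥ 0 set v^g = M^g·(1,0,0,0,0,0)ᵗ with first component ẽ₀^g. For g ≥ 1 define in ℚ[q]: m₀^g = (q³−q)^{2g−2} + (q²−1)^{2g−2} −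 q(q²−q)^{2g−2} − q^{2g−2} + (1/2)q^{2g−1}((q−1)^{2g−2} + (q+1)^{2g−2}) + (1/2)q((q+1)^{2g−1} + (q−1)^{2g−1}), and R_g = (q³−q)·((1/2)((q+1)^{2g−1} − (q−1)^{2g−1}) + q^{2g−2} + (q−1)(q²−q)^{2g−2}). Then for every g ≥ 1, the identity (q³−q)·m₀^g = ẽ₀^g − R_g + (q³−q)·(1/2)((q−1)^{2g} + (q+1)^{2g}) holds in ℚ[q]. -/
open Polynomial Matrix

noncomputable section

/-- The indeterminate `q` of `ℚ[q]`. -/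
def x : Polynomial ℚ := Polynomial.X

/-- `m₀^g`, the E-polynomial of the character variety `M_{Id}^g`. -/
def m0 (g : ℕ) : Polynomial ℚ :=
  (x^3-x)^(2*g-2) + (x^2-1)^(2*g-2) - x*(x^2-x)^(2*g-2) - x^(2*g-2)
    + C (1/2 : ℚ) * x^(2*g-1) * ((x-1)^(2*g-2) + (x+1)^(2*g-2))
    + C (1/2 : ℚ) * x * ((x+1)^(2*g-1) + (x-1)^(2*g-1))

/-- `R_g`, the E-polynomial of the reducible locus of the genus-`g`
`PGL(2,ℂ)`-representation variety with trivial boundary holonomy. -/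
def R (g : ℕ) : Polynomial ℚ :=
  (x^3-x) * (C (1/2 : ℚ) * ((x+1)^(2*g-1) - (x-1)^(2*g-1))
    + x^(2*g-2) + (x-1)*(x^2-x)^(2*g-2))

theorem v_succ_s13 (n : ℕ) : v (n + 1) = M.mulVec (v n) := by
  simp [v, pow_succ', Matrix.mulVec_mulVec]

/-- Spectral decomposition of `2 M^{n+1} e₀`: only four eigenvalues of `M` contribute. -/
theorem two_mul_v_succ (n : ℕ) (i : Fin 6) :
    2 * v (n + 1) i =
      ((q^3-q)^2)^n * ![2*(q^3-q), 2*(q^3-q), 2*(q^3-q), 2*(q^3-q), 2*(q^3-q), 0] i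
      + ((q^2-1)^2)^n * ![2*(q^3-q), 2*(q^3-q), 0, 0, 0, 2*(q^2-1)] i
      + ((q^2-q)^2)^n * ![q^4-2*q^3-q^2+2*q, q-q^3, q^3-3*q^2+2*q, q-q^2, q-q^2, q-q^2] i
      + ((q^2+q)^2)^n * ![q^4-q^2, q-q^3, -q^2-q^3, q+q^2, q+q^2, -q-q^2] i := by
  induction n generalizing i with
  | zero =>
    rw [v_succ_s13]
    have h : v 0 = ![1, 0, 0, 0, 0, 0] := by simp [v]
    rw [h]
    fin_cases i <;> simp [M, Matrix.mulVec, dotProduct, Fin.sum_univ_succ] <;> ring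
  | succ n ih =>
    rw [v_succ_s13]
    have h0 := ih 0
    have h1 := ih 1
    have h2 := ih 2
    have h3 := ih 3
    have h4 := ih 4
    have h5 := ih 5
    have key : 2 * M.mulVec (v (n + 1)) i =
        M i 0 * (2 * v (n + 1) 0) + M i 1 * (2 * v (n + 1) 1) + M i 2 * (2 * v (n + 1) 2)
        + M i 3 * (2 * v (n + 1) 3) + M i 4 * (2 * v (n + 1) 4) + M i 5 * (2 * v (n + 1) 5) := by
      simp only [Matrix.mulVec, dotProduct, Fin.sum_univ_six]
      ring
    rw [key, h0, h1, h2, h3, h4, h5]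
    simp only [pow_succ _ n]
    generalize ((q^3-q)^2)^n = a
    generalize ((q^2-1)^2)^n = b
    generalize ((q^2-q)^2)^n = c
    generalize ((q^2+q)^2)^n = d
    fin_cases i <;> simp [M] <;> ring

theorem stmt_13 (g : ℕ) (hg : 1 ≤ g) :
    (x^3-x) * m0 g =
      (v g 0).map (Int.castRingHom ℚ) - R g
        + (x^3-x) * (C (1/2 : ℚ) * ((x-1)^(2*g) + (x+1)^(2*g))) := by
  obtain ⟨n, rfl⟩ := Nat.exists_eq_add_of_le' hg
  have hv := congrArg (Polynomial.map (Int.castRingHom ℚ)) (two_mul_v_succ n 0)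
  have hq : q.map (Int.castRingHom ℚ) = x := by simp [q, x]
  simp only [Matrix.cons_val_zero, Polynomial.map_add, Polynomial.map_mul, Polynomial.map_sub,
    Polynomial.map_pow, Polynomial.map_one, Polynomial.map_ofNat, hq] at hv
  have hC : (2 : Polynomial ℚ) * C (1/2 : ℚ) = 1 := by
    rw [← Polynomial.C_ofNat, ← Polynomial.C_mul]
    norm_num
  have e0 : 2 * (n + 1) - 2 = 2 * n := by omega
  have e1 : 2 * (n + 1) - 1 = 2 * n + 1 := by omega
  have e2 : 2 * (n + 1) = 2 * n + 2 := by omega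
  simp only [m0, R, e0, e1]
  rw [e2]
  have f0 : x^3-x = x*((x-1)*(x+1)) := by ring
  have f1 : x^2-1 = (x-1)*(x+1) := by ring
  have f2 : x^2-x = x*(x-1) := by ring
  have f3 : x^2+x = x*(x+1) := by ring
  simp only [← pow_mul, f0, f1, f2, f3, mul_pow, pow_add] at hv ⊢
  generalize x^(2*n) = a at *
  generalize (x-1)^(2*n) = b at *
  generalize (x+1)^(2*n) = c at *
  generalize (v (n + 1) 0).map (Int.castRingHom ℚ) = w at *
  generalize C (1/2 : ℚ) = h at *
  have h2 : (2 : Polynomial ℚ) ≠ 0 := two_ne_zero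
  apply mul_left_cancel₀ h2
  linear_combination -hv + (x*((x-1)*(x+1))) * (a*x*(b+c) + x*(c*(x+1) + b*(x-1))
    + (c*(x+1) - b*(x-1)) - (b*(x-1)^2 + c*(x+1)^2)) * hC
end
end
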